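/- arXiv:1509.05241 — 3 statements merged into one kernel-verified Lean document; each statement's English description precedes it below -/
import Mathlib

section
/- Let $n, r, m$ be positive integers with $r \le n$, $\binom{n-r+1}{2} \le m$ and $\binom{r+1}{2} \le \binom{n+1}{2} - m$, and set $k = m - \binom{n-r+1}{2}$ and $l = \binom{n+1}{2} - m - \binom{r+1}{2}$. Then the function $\lambda = (\lambda_1,\dots,\lambda_n) \mapsto \sum_{I} \frac{A_{k,I^c}(\lambda)\, A_{l,I}(\lambda)}{T_I(\lambda)}$, where the sum runs over all $r$-element subsets $I$ of $\{1,\dots,n\}$ and $I^c$ denotes the complement of $I$, is constant on the set of tuples $\lambda \in \mathbb{Q}^n$ (equivalently $\mathbb{R}^n$) with pairwise distinct coordinates: for any two tuples $\lambda, \mu$ each having pairwise distinct coordinates, the two sums are equal. -/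
open Finset

/-- `c_{i,I}(λ)`: the `i`-th elementary symmetric polynomial evaluated at the multiset
of numbers `λ i + λ j` for `i ≤ j`, `i, j ∈ I` (equivalently, the sums `∑_{i ∈ I} a i * λ i`
over `a : I → {0,1,2}` with `∑ a i = 2`). -/
def esymC {n : ℕ} (lam : Fin n → ℚ) (I : Finset (Fin n)) (i : ℕ) : ℚ :=
  (I.sym2.val.map (Sym2.lift ⟨fun a b => lam a + lam b, fun a b => by ring⟩)).esymm i

/-- `A_{i,I}(λ)`: the determinant of the `i × i` matrix whose `(p,q)` entry is
`c_{q-p+1,I}(λ)` when `q - p + 1 ≥ 0` (with `c_{0,I} = 1`) and `0` when `q - p + 1 < 0`.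
For `i = 0` this is the empty determinant, which equals `1`. -/
def detA {n : ℕ} (lam : Fin n → ℚ) (I : Finset (Fin n)) (i : ℕ) : ℚ :=
  Matrix.det (fun p q : Fin i =>
    if (p : ℕ) ≤ (q : ℕ) + 1 then esymC lam I ((q : ℕ) + 1 - (p : ℕ)) else 0)

/-- `T_I(λ) = ∏_{i ∈ I} ∏_{j ∉ I} (λ j - λ i)`. -/
def prodT {n : ℕ} (lam : Fin n → ℚ) (I : Finset (Fin n)) : ℚ :=
  ∏ i ∈ I, ∏ j ∈ Iᶜ, (lam j - lam i)

open MvPolynomial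

/-- The `i`-th elementary symmetric function of the sums `v a + v b` over unordered pairs in `I`. -/
def pairSumEsymm {n : ℕ} {R : Type*} [CommRing R] (v : Fin n → R) (I : Finset (Fin n)) (i : ℕ) : R :=
  ∑ t ∈ I.sym2.powersetCard i, ∏ z ∈ t, Sym2.lift ⟨fun a b => v a + v b, fun _ _ => add_comm _ _⟩ z

/-- The counterpart of `detA` over an arbitrary commutative ring. -/
def pairSumDet {n : ℕ} {R : Type*} [CommRing R] (v : Fin n → R) (I : Finset (Fin n)) (i : ℕ) : R :=
  Matrix.det (Matrix.of fun p q : Fin i =>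
    if (p : ℕ) ≤ (q : ℕ) + 1 then pairSumEsymm v I ((q : ℕ) + 1 - (p : ℕ)) else 0)

theorem detA_eq_pairSumDet {n : ℕ} (lam : Fin n → ℚ) (I : Finset (Fin n)) (i : ℕ) :
    detA lam I i = pairSumDet lam I i := by
  simp only [detA, pairSumDet, esymC, pairSumEsymm, Finset.esymm_map_val]
  rfl

theorem map_pairSumEsymm {n : ℕ} {R S : Type*} [CommRing R] [CommRing S] (f : R →+* S)
    (v : Fin n → R) (I : Finset (Fin n)) (i : ℕ) :
    f (pairSumEsymm v I i) = pairSumEsymm (f ∘ v) I i := by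
  simp only [pairSumEsymm, map_sum, map_prod]
  refine sum_congr rfl fun t _ => prod_congr rfl fun z _ => ?_
  induction z with
  | h a b => simp

theorem map_pairSumDet {n : ℕ} {R S : Type*} [CommRing R] [CommRing S] (f : R →+* S)
    (v : Fin n → R) (I : Finset (Fin n)) (i : ℕ) :
    f (pairSumDet v I i) = pairSumDet (f ∘ v) I i := by
  rw [pairSumDet, pairSumDet, RingHom.map_det]
  congr 1
  ext p q
  simp only [RingHom.mapMatrix_apply, Matrix.map_apply, Matrix.of_apply]
  split_ifs
  · rw [map_pairSumEsymm]
  · exact map_zero f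

theorem pairSumEsymm_comp_perm {n : ℕ} {R : Type*} [CommRing R] (v : Fin n → R)
    (σ : Equiv.Perm (Fin n)) (I : Finset (Fin n)) (i : ℕ) :
    pairSumEsymm (v ∘ σ) I i = pairSumEsymm v (I.map σ.toEmbedding) i := by
  simp only [pairSumEsymm, Finset.sym2_map, powersetCard_map, sum_map]
  refine sum_congr rfl fun t _ => ?_
  simp only [mapEmbedding_apply, RelEmbedding.coe_toEmbedding, prod_map]
  refine prod_congr rfl fun z _ => ?_
  induction z with
  | h a b => simp

theorem pairSumDet_comp_perm {n : ℕ} {R : Type*} [CommRing R] (v : Fin n → R)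
    (σ : Equiv.Perm (Fin n)) (I : Finset (Fin n)) (i : ℕ) :
    pairSumDet (v ∘ σ) I i = pairSumDet v (I.map σ.toEmbedding) i := by
  simp only [pairSumDet, pairSumEsymm_comp_perm]

theorem isHomogeneous_pairSumEsymm {n : ℕ} (I : Finset (Fin n)) (i : ℕ) :
    (pairSumEsymm (X : Fin n → MvPolynomial (Fin n) ℚ) I i).IsHomogeneous i := by
  refine IsHomogeneous.sum _ _ _ fun t ht => ?_
  rw [← (mem_powersetCard.1 ht).2, card_eq_sum_ones]
  refine IsHomogeneous.prod _ _ _ fun z _ => ?_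
  induction z with
  | h a b => exact (isHomogeneous_X _ a).add (isHomogeneous_X _ b)

theorem isHomogeneous_det {n d : ℕ} {τ R : Type*} [CommRing R]
    (M : Matrix (Fin n) (Fin n) (MvPolynomial τ R))
    (h : ∀ σ : Equiv.Perm (Fin n), (∏ i, M (σ i) i).IsHomogeneous d) :
    M.det.IsHomogeneous d := by
  rw [Matrix.det_apply]
  refine IsHomogeneous.sum _ _ _ fun σ _ => ?_
  rcases Int.units_eq_one_or (Equiv.Perm.sign σ) with hs | hs
  · simpa [hs] using h σ
  · simpa [hs] using (h σ).neg

theorem isHomogeneous_pairSumDet {n : ℕ} (I : Finset (Fin n)) (i : ℕ) :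
    (pairSumDet (X : Fin n → MvPolynomial (Fin n) ℚ) I i).IsHomogeneous i := by
  refine isHomogeneous_det _ fun σ => ?_
  by_cases hσ : ∀ q, (σ q : ℕ) ≤ (q : ℕ) + 1
  · have hdeg : ∑ q : Fin i, ((q : ℕ) + 1 - (σ q : ℕ)) = i := by
      have h1 : ∑ q : Fin i, ((q : ℕ) + 1 - (σ q : ℕ)) + ∑ q : Fin i, (σ q : ℕ) =
          ∑ q : Fin i, (q : ℕ) + i := by
        rw [← sum_add_distrib, sum_congr rfl fun q _ => Nat.sub_add_cancel (hσ q)]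
        simp [sum_add_distrib]
      rw [Equiv.sum_comp σ fun q : Fin i => (q : ℕ)] at h1
      omega
    have := IsHomogeneous.prod univ
      (fun q : Fin i => pairSumEsymm (X : Fin n → MvPolynomial (Fin n) ℚ) I ((q : ℕ) + 1 - (σ q : ℕ)))
      _ fun q _ => isHomogeneous_pairSumEsymm I _
    rw [hdeg] at this
    simpa [hσ] using this
  · push Not at hσ
    obtain ⟨q, hq⟩ := hσ
    rw [prod_eq_zero (mem_univ q) (if_neg (by omega))]
    exact isHomogeneous_zero _ _ _

/-- The Vandermonde polynomial in `n` variables. -/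
noncomputable def vandermondePoly (n : ℕ) : MvPolynomial (Fin n) ℚ :=
  (Matrix.vandermonde X).det

theorem isHomogeneous_vandermondePoly (n : ℕ) :
    (vandermondePoly n).IsHomogeneous (∑ i : Fin n, (i : ℕ)) :=
  isHomogeneous_det _ fun _ => IsHomogeneous.prod _ _ _ fun i _ => isHomogeneous_X_pow _ (i : ℕ)

theorem vandermondePoly_ne_zero (n : ℕ) : vandermondePoly n ≠ 0 :=
  Matrix.det_vandermonde_ne_zero_iff.2 X_injective

theorem rename_vandermondePoly {n : ℕ} (σ : Equiv.Perm (Fin n)) :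
    rename σ (vandermondePoly n) = (Equiv.Perm.sign σ : ℤ) * vandermondePoly n := by
  rw [vandermondePoly, ← Matrix.det_permute, AlgHom.map_det]
  congr 1
  ext p q
  simp [Matrix.vandermonde_apply]

theorem eval_vandermondePoly_ne_zero {n : ℕ} {lam : Fin n → ℚ} (h : Function.Injective lam) :
    eval lam (vandermondePoly n) ≠ 0 := by
  have : eval lam (vandermondePoly n) = (Matrix.vandermonde lam).det := by
    rw [vandermondePoly, RingHom.map_det]
    congr 1
    ext p q
    simp [Matrix.vandermonde_apply]
  rw [this]
  exact Matrix.det_vandermonde_ne_zero_iff.2 h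

theorem exists_perm_of_injective_of_sum_eq {n : ℕ} (d : Fin n → ℕ) (hd : Function.Injective d)
    (hsum : ∑ i, d i = ∑ i : Fin n, (i : ℕ)) :
    ∃ σ : Equiv.Perm (Fin n), ∀ i, d (σ i) = i := by
  have hmono : StrictMono (d ∘ Tuple.sort d) :=
    (Tuple.monotone_sort d).strictMono_of_injective (hd.comp (Tuple.sort d).injective)
  have hle : ∀ i : Fin n, (i : ℕ) ≤ d (Tuple.sort d i) := by
    rintro ⟨i, hi⟩
    induction i with
    | zero => exact Nat.zero_le _
    | succ j ih =>
      have := ih (by omega)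
      have hlt : d (Tuple.sort d ⟨j, by omega⟩) < d (Tuple.sort d ⟨j + 1, hi⟩) :=
        hmono (Fin.mk_lt_mk.2 (Nat.lt_succ_self j))
      simp only at this ⊢
      omega
  refine ⟨Tuple.sort d, fun i => ?_⟩
  refine ((sum_eq_sum_iff_of_le fun i _ => hle i).1 ?_ i (mem_univ i)).symm
  rw [← hsum, Equiv.sum_comp (Tuple.sort d) d]

/-- An alternating polynomial whose degree is that of the Vandermonde polynomial vanishes as soon
as its coefficient at `∏ i, X i ^ i` does. -/
theorem eq_zero_of_alternating_of_coeff_eq_zero {n : ℕ} {p : MvPolynomial (Fin n) ℚ}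
    (hp : p.IsHomogeneous (∑ i : Fin n, (i : ℕ)))
    (halt : ∀ σ : Equiv.Perm (Fin n), rename σ p = (Equiv.Perm.sign σ : ℤ) * p)
    (h0 : p.coeff (Finsupp.equivFunOnFinite.symm fun i : Fin n => (i : ℕ)) = 0) : p = 0 := by
  have key : ∀ (σ : Equiv.Perm (Fin n)) (d : Fin n →₀ ℕ),
      p.coeff d = (Equiv.Perm.sign σ : ℤ) * p.coeff (d.mapDomain σ) := by
    intro σ d
    rw [← coeff_rename_mapDomain σ σ.injective, halt]
    rcases Int.units_eq_one_or (Equiv.Perm.sign σ) with hs | hs <;> simp [hs]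
  ext d
  rw [coeff_zero]
  by_contra hd
  have hdeg : ∑ i, d i = ∑ i : Fin n, (i : ℕ) := by
    rw [← Finsupp.degree_eq_sum]
    by_contra h
    exact hd (hp.coeff_eq_zero h)
  have hinj : Function.Injective d := by
    intro i j hij
    by_contra hne
    have hfix : d.mapDomain (Equiv.swap i j) = d := by
      ext a
      rw [← Finsupp.equivMapDomain_eq_mapDomain, Finsupp.equivMapDomain_apply, Equiv.symm_swap]
      by_cases hi : a = i
      · simp [hi, hij]
      · by_cases hj : a = j
        · simp [hj, hij]
        · rw [Equiv.swap_apply_of_ne_of_ne hi hj]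
    have := key (Equiv.swap i j) d
    rw [hfix, Equiv.Perm.sign_swap hne] at this
    push_cast at this
    exact hd (by linarith)
  obtain ⟨σ, hσ⟩ := exists_perm_of_injective_of_sum_eq d hinj hdeg
  apply hd
  rw [key σ⁻¹ d]
  have : d.mapDomain (σ⁻¹ : Equiv.Perm (Fin n)) =
      Finsupp.equivFunOnFinite.symm fun i : Fin n => (i : ℕ) := by
    ext a
    rw [← Finsupp.equivMapDomain_eq_mapDomain, Finsupp.equivMapDomain_apply]
    exact hσ a
  rw [this, h0, mul_zero]

theorem exists_eq_C_mul_vandermondePoly {n : ℕ} {p : MvPolynomial (Fin n) ℚ}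
    (hp : p.IsHomogeneous (∑ i : Fin n, (i : ℕ)))
    (halt : ∀ σ : Equiv.Perm (Fin n), rename σ p = (Equiv.Perm.sign σ : ℤ) * p) :
    ∃ c : ℚ, p = C c * vandermondePoly n := by
  set δ : Fin n →₀ ℕ := Finsupp.equivFunOnFinite.symm fun i : Fin n => (i : ℕ)
  have hV : (vandermondePoly n).coeff δ ≠ 0 := fun h => vandermondePoly_ne_zero n
    (eq_zero_of_alternating_of_coeff_eq_zero (isHomogeneous_vandermondePoly n)
      rename_vandermondePoly h)
  refine ⟨p.coeff δ / (vandermondePoly n).coeff δ, sub_eq_zero.1 ?_⟩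
  refine eq_zero_of_alternating_of_coeff_eq_zero
    (hp.sub ((isHomogeneous_vandermondePoly n).C_mul _)) (fun σ => ?_) ?_
  · rw [map_sub, map_mul, rename_C, halt, rename_vandermondePoly]
    ring
  · rw [coeff_sub, coeff_C_mul, div_mul_cancel₀ _ hV, sub_self]

/-- The polynomial whose values are `prodT`. -/
noncomputable def prodTPoly {n : ℕ} (I : Finset (Fin n)) : MvPolynomial (Fin n) ℚ :=
  ∏ i ∈ I, ∏ j ∈ Iᶜ, (X j - X i)

theorem eval_prodTPoly {n : ℕ} (lam : Fin n → ℚ) (I : Finset (Fin n)) :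
    eval lam (prodTPoly I) = prodT lam I := by
  simp [prodTPoly, prodT, map_prod]

theorem prodTPoly_ne_zero {n : ℕ} (I : Finset (Fin n)) : prodTPoly I ≠ 0 := by
  refine prod_ne_zero_iff.2 fun i hi => prod_ne_zero_iff.2 fun j hj => ?_
  rw [sub_ne_zero, X_injective.ne_iff]
  rintro rfl
  exact mem_compl.1 hj hi

theorem isHomogeneous_prodTPoly {n : ℕ} (I : Finset (Fin n)) :
    (prodTPoly I).IsHomogeneous (#I * #Iᶜ) := by
  rw [← smul_eq_mul, ← sum_const]
  refine IsHomogeneous.prod _ _ _ fun i _ => ?_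
  rw [card_eq_sum_ones]
  exact IsHomogeneous.prod _ _ _ fun j _ => (isHomogeneous_X _ j).sub (isHomogeneous_X _ i)

theorem rename_prodTPoly {n : ℕ} (σ : Equiv.Perm (Fin n)) (I : Finset (Fin n)) :
    rename σ (prodTPoly I) = prodTPoly (I.map σ.toEmbedding) := by
  have : (I.map σ.toEmbedding)ᶜ = Iᶜ.map σ.toEmbedding := by
    ext; simp
  simp [prodTPoly, map_prod, this]

theorem exists_prodTPoly_mul_eq {n : ℕ} (I : Finset (Fin n)) :
    ∃ (W : MvPolynomial (Fin n) ℚ) (e : ℕ),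
      W.IsHomogeneous e ∧ prodTPoly I * W = vandermondePoly n := by
  let g : Fin n × Fin n → MvPolynomial (Fin n) ℚ := fun p => X p.2 - X p.1
  let ε : Fin n × Fin n → MvPolynomial (Fin n) ℚ := fun p => if p.1 < p.2 then 1 else -1
  have hV : vandermondePoly n = ∏ p : Fin n × Fin n with p.1 < p.2, g p := by
    rw [vandermondePoly, Matrix.det_vandermonde, prod_filter, Fintype.prod_prod_type]
    refine prod_congr rfl fun i _ => ?_
    rw [← prod_filter, filter_lt_eq_Ioi]
  have hT : prodTPoly I = (∏ p ∈ I ×ˢ Iᶜ, ε p) *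
      ∏ p : Fin n × Fin n with p.1 < p.2 ∧ ¬(p.1 ∈ I ↔ p.2 ∈ I), g p := by
    have : ∏ p : Fin n × Fin n with p.1 < p.2 ∧ ¬(p.1 ∈ I ↔ p.2 ∈ I), g p =
        ∏ p ∈ I ×ˢ Iᶜ, g (if p.1 < p.2 then p else p.swap) := by
      refine prod_nbij' (fun p => if p.1 ∈ I then p else p.swap)
        (fun p => if p.1 < p.2 then p else p.swap) ?_ ?_ ?_ ?_ ?_
      · rintro ⟨a, b⟩ h
        simp only [mem_filter, mem_univ, true_and] at h
        by_cases ha : a ∈ I <;> simp_all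
      · rintro ⟨a, b⟩ h
        simp only [mem_product, mem_compl] at h
        have hab : a ≠ b := by rintro rfl; exact h.2 h.1
        by_cases hlt : a < b
        · simp [hlt, h]
        · simp [hlt, h, lt_of_le_of_ne (not_lt.1 hlt) hab.symm]
      · rintro ⟨a, b⟩ h
        simp only [mem_filter, mem_univ, true_and] at h
        by_cases ha : a ∈ I <;> simp [ha, h.1, h.1.le, not_lt.2]
      · rintro ⟨a, b⟩ h
        simp only [mem_product, mem_compl] at h
        by_cases hlt : a < b <;> simp [hlt, h]
      · rintro ⟨a, b⟩ h
        simp only [mem_filter, mem_univ, true_and] at h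
        by_cases ha : a ∈ I <;> simp [ha, h.1, h.1.le, not_lt.2]
    rw [this, ← prod_mul_distrib, prodTPoly, ← prod_product']
    refine prod_congr rfl fun p _ => ?_
    by_cases hlt : p.1 < p.2 <;> simp [g, ε, hlt]
  have hε : (∏ p ∈ I ×ˢ Iᶜ, ε p) * ∏ p ∈ I ×ˢ Iᶜ, ε p = 1 := by
    rw [← prod_mul_distrib]
    refine prod_eq_one fun p _ => ?_
    by_cases hlt : p.1 < p.2 <;> simp [ε, hlt]
  have hεhom : (∏ p ∈ I ×ˢ Iᶜ, ε p).IsHomogeneous (∑ p ∈ I ×ˢ Iᶜ, 0) := by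
    refine IsHomogeneous.prod _ _ _ fun p _ => ?_
    by_cases hlt : p.1 < p.2
    · simpa [ε, hlt] using isHomogeneous_one (Fin n) ℚ
    · simpa [ε, hlt] using (isHomogeneous_one (Fin n) ℚ).neg
  refine ⟨(∏ p ∈ I ×ˢ Iᶜ, ε p) *
    ∏ p : Fin n × Fin n with p.1 < p.2 ∧ (p.1 ∈ I ↔ p.2 ∈ I), g p, _,
    hεhom.mul (IsHomogeneous.prod _ _ (fun _ => 1) fun p _ =>
      (isHomogeneous_X _ p.2).sub (isHomogeneous_X _ p.1)), ?_⟩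
  rw [hV, hT, ← prod_filter_mul_prod_filter_not (univ.filter fun p : Fin n × Fin n => p.1 < p.2)
    (fun p => p.1 ∈ I ↔ p.2 ∈ I), filter_filter, filter_filter]
  linear_combination (∏ p : Fin n × Fin n with p.1 < p.2 ∧ ¬(p.1 ∈ I ↔ p.2 ∈ I), g p) *
    (∏ p : Fin n × Fin n with p.1 < p.2 ∧ (p.1 ∈ I ↔ p.2 ∈ I), g p) * hε

theorem exists_const_sum_div_prodT {n r k l : ℕ} (hkl : k + l = r * (n - r)) :
    ∃ c : ℚ, ∀ lam : Fin n → ℚ, Function.Injective lam →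
      ∑ I ∈ (Finset.univ : Finset (Fin n)).powersetCard r,
        detA lam Iᶜ k * detA lam I l / prodT lam I = c := by
  choose W e hW hTW using exists_prodTPoly_mul_eq (n := n)
  let F : Finset (Fin n) → MvPolynomial (Fin n) ℚ := fun I => pairSumDet X Iᶜ k * pairSumDet X I l
  have hFσ : ∀ (σ : Equiv.Perm (Fin n)) I, rename σ (F I) = F (I.map σ.toEmbedding) := by
    intro σ I
    have hcompl : (I.map σ.toEmbedding)ᶜ = Iᶜ.map σ.toEmbedding := by
      ext; simp
    have hX : ∀ J i, rename σ (pairSumDet (X : Fin n → MvPolynomial (Fin n) ℚ) J i) =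
        pairSumDet X (J.map σ.toEmbedding) i := by
      intro J i
      rw [← pairSumDet_comp_perm]
      convert! map_pairSumDet (rename σ : _ →ₐ[ℚ] MvPolynomial (Fin n) ℚ).toRingHom X J i using 2
      ext j : 1
      simp
    simp only [F, map_mul, hX, hcompl]
  have hWσ : ∀ (σ : Equiv.Perm (Fin n)) I,
      rename σ (W I) = (Equiv.Perm.sign σ : ℤ) * W (I.map σ.toEmbedding) := by
    intro σ I
    apply mul_left_cancel₀ (prodTPoly_ne_zero (I.map σ.toEmbedding))
    rw [← rename_prodTPoly, ← map_mul, hTW, rename_vandermondePoly, rename_prodTPoly,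
      mul_left_comm, hTW]
  obtain ⟨c, hc⟩ := exists_eq_C_mul_vandermondePoly
    (p := ∑ I ∈ (Finset.univ : Finset (Fin n)).powersetCard r, F I * W I)
    (IsHomogeneous.sum _ _ _ fun I hI => by
      have hcard : #I = r := (mem_powersetCard.1 hI).2
      have hF : (F I).IsHomogeneous (#I * #Iᶜ) := by
        rw [card_compl, Fintype.card_fin, hcard, ← hkl]
        exact (isHomogeneous_pairSumDet _ _).mul (isHomogeneous_pairSumDet _ _)
      have hdeg : #I * #Iᶜ + e I = ∑ i : Fin n, (i : ℕ) :=
        IsHomogeneous.inj_right (hTW I ▸ (isHomogeneous_prodTPoly I).mul (hW I))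
          (isHomogeneous_vandermondePoly n) (vandermondePoly_ne_zero n)
      exact hdeg ▸ hF.mul (hW I))
    (fun σ => by
      rw [map_sum, mul_sum]
      refine sum_equiv (Equiv.finsetCongr σ) (fun I => ?_) (fun I _ => ?_)
      · simp [mem_powersetCard]
      · rw [map_mul, hFσ, hWσ, Equiv.finsetCongr_apply]
        ring)
  refine ⟨c, fun lam hlam => ?_⟩
  have hV := eval_vandermondePoly_ne_zero hlam
  have heval : ∀ J i, eval lam (pairSumDet X J i) = detA lam J i := by
    intro J i
    rw [detA_eq_pairSumDet, map_pairSumDet]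
    congr 1
    ext j
    simp
  have hc' := congrArg (eval lam) hc
  rw [map_sum, map_mul, eval_C] at hc'
  rw [← mul_left_inj' hV, ← hc', sum_mul]
  refine sum_congr rfl fun I _ => ?_
  have hT : prodT lam I ≠ 0 := by
    intro h
    rw [← hTW I, map_mul, eval_prodTPoly, h, zero_mul] at hV
    exact hV rfl
  rw [← hTW I, map_mul, map_mul, map_mul, eval_prodTPoly, heval, heval]
  field_simp

/-- The Bott residue sum `∑_I A_{k,Iᶜ}(λ) A_{l,I}(λ) / T_I(λ)` is independent of the
choice of the tuple `λ` with pairwise distinct coordinates. -/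
theorem bott_residue_sum_constant (n r m : ℕ) (hn : 0 < n) (hr : 0 < r) (hm : 0 < m)
    (hrn : r ≤ n) (h1 : (n - r + 1).choose 2 ≤ m)
    (h2 : (r + 1).choose 2 ≤ (n + 1).choose 2 - m)
    (k l : ℕ) (hk : k = m - (n - r + 1).choose 2)
    (hl : l = (n + 1).choose 2 - m - (r + 1).choose 2)
    (lam mu : Fin n → ℚ) (hlam : Function.Injective lam) (hmu : Function.Injective mu) :
    ∑ I ∈ (Finset.univ : Finset (Fin n)).powersetCard r,
        detA lam Iᶜ k * detA lam I l / prodT lam I =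
      ∑ I ∈ (Finset.univ : Finset (Fin n)).powersetCard r,
        detA mu Iᶜ k * detA mu I l / prodT mu I := by

  have hkl : k + l = r * (n - r) := by
    obtain ⟨s, rfl⟩ := Nat.exists_eq_add_of_le hrn
    have hr' : 0 < (r + 1).choose 2 := Nat.choose_pos (by omega)
    have key : (r + s + 1).choose 2 = (r + 1).choose 2 + (s + 1).choose 2 + r * s := by
      have h (a : ℕ) : (((a + 1).choose 2 : ℕ) : ℚ) = (a + 1) * a / 2 := by
        rw [Nat.cast_choose_two]; push_cast; ring
      have : (((r + s + 1).choose 2 : ℕ) : ℚ) =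
          (r + 1).choose 2 + (s + 1).choose 2 + r * s := by
        rw [h, h, h]; push_cast; ring
      exact_mod_cast this
    rw [Nat.add_sub_cancel_left] at *
    omega
  obtain ⟨c, hc⟩ := exists_const_sum_div_prodT hkl
  rw [hc lam hlam, hc mu hmu]
end

section
/- Let $n, r, m$ be positive integers with $r \le n$, $\binom{n-r+1}{2} \le m$ and $\binom{r+1}{2} \le \binom{n+1}{2} - m$, and set $k = m - \binom{n-r+1}{2}$ and $l = \binom{n+1}{2} - m - \binom{r+1}{2}$. Then there exists an integer $\delta \in \mathbb{Z}$ such that for every tuple $\lambda = (\lambda_1,\dots,\lambda_n) \in \mathbb{Q}^n$ with pairwise distinct coordinates, $(-1)^{l} \sum_{I} \frac{A_{k,I^c}(\lambda)\, A_{l,I}(\lambda)}{T_I(\lambda)} = \delta$, where the sum runs over all $r$-element subsets $I$ of $\{1,\dots,n\}$ and $I^c$ denotes the complement of $I$. -/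
open Finset

namespace BottResidue

variable {n : ℕ} {R S : Type*} [CommRing R] [CommRing S]

/-- The function sending the unordered pair `{i, j}` to `x i + x j`. -/
def pairSum (x : Fin n → R) : Sym2 (Fin n) → R :=
  Sym2.lift ⟨fun a b => x a + x b, fun _ _ => add_comm _ _⟩

/-- The elementary symmetric polynomial in the sums `x i + x j` with `i, j ∈ I`, over an
arbitrary commutative ring. -/
def pairEsymm (x : Fin n → R) (I : Finset (Fin n)) (i : ℕ) : R :=
  ∑ t ∈ I.sym2.powersetCard i, ∏ s ∈ t, pairSum x s

/-- The Jacobi–Trudi determinant in the `pairEsymm`, over an arbitrary commutative ring. -/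
def pairDet (x : Fin n → R) (I : Finset (Fin n)) (i : ℕ) : R :=
  Matrix.det (Matrix.of fun p q : Fin i =>
    if (p : ℕ) ≤ (q : ℕ) + 1 then pairEsymm x I ((q : ℕ) + 1 - (p : ℕ)) else 0)

theorem map_pairSum (f : R →+* S) (x : Fin n → R) (s : Sym2 (Fin n)) :
    f (pairSum x s) = pairSum (f ∘ x) s := by
  induction s with
  | _ a b => simp [pairSum]

theorem map_pairEsymm (f : R →+* S) (x : Fin n → R) (I : Finset (Fin n)) (i : ℕ) :
    f (pairEsymm x I i) = pairEsymm (f ∘ x) I i := by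
  simp [pairEsymm, map_pairSum]

theorem map_pairDet (f : R →+* S) (x : Fin n → R) (I : Finset (Fin n)) (i : ℕ) :
    f (pairDet x I i) = pairDet (f ∘ x) I i := by
  rw [pairDet, RingHom.map_det, pairDet]
  congr 1
  ext p q
  simp only [RingHom.mapMatrix_apply, Matrix.map_apply, Matrix.of_apply]
  split_ifs
  · exact map_pairEsymm f x I _
  · exact map_zero f

theorem pairEsymm_comp_equiv (x : Fin n → R) (e : Equiv.Perm (Fin n)) (I : Finset (Fin n))
    (i : ℕ) : pairEsymm (x ∘ e) I i = pairEsymm x (I.map e.toEmbedding) i := by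
  have h (s : Sym2 (Fin n)) : pairSum (x ∘ e) s = pairSum x (s.map e) := by
    induction s with
    | _ a b => rfl
  simp [pairEsymm, Finset.sym2_map, Finset.powersetCard_map, h]

theorem pairDet_comp_equiv (x : Fin n → R) (e : Equiv.Perm (Fin n)) (I : Finset (Fin n))
    (i : ℕ) : pairDet (x ∘ e) I i = pairDet x (I.map e.toEmbedding) i := by
  simp only [pairDet, pairEsymm_comp_equiv]

theorem esymC_eq_pairEsymm (lam : Fin n → ℚ) (I : Finset (Fin n)) (i : ℕ) :
    esymC lam I i = pairEsymm lam I i :=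
  Finset.esymm_map_val _ _ _

theorem detA_eq_pairDet (lam : Fin n → ℚ) (I : Finset (Fin n)) (i : ℕ) :
    detA lam I i = pairDet lam I i := by
  simp only [detA, pairDet, esymC_eq_pairEsymm]
  rfl

open MvPolynomial

theorem isHomogeneous_pairEsymm (I : Finset (Fin n)) (i : ℕ) :
    (pairEsymm (X : Fin n → MvPolynomial (Fin n) ℤ) I i).IsHomogeneous i := by
  refine IsHomogeneous.sum _ _ _ fun t ht => ?_
  have h := IsHomogeneous.prod t (pairSum (X : Fin n → MvPolynomial (Fin n) ℤ)) (fun _ => 1)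
    fun s _ => by
      induction s with
      | _ a b => exact (isHomogeneous_X ℤ a).add (isHomogeneous_X ℤ b)
  simpa [(Finset.mem_powersetCard.1 ht).2] using h

theorem isHomogeneous_pairDet (I : Finset (Fin n)) (i : ℕ) :
    (pairDet (X : Fin n → MvPolynomial (Fin n) ℤ) I i).IsHomogeneous i := by
  rw [pairDet, Matrix.det_apply']
  refine IsHomogeneous.sum _ _ _ fun σ _ => ?_
  rw [← map_intCast (C : ℤ →+* MvPolynomial (Fin n) ℤ)]
  refine IsHomogeneous.C_mul ?_ _
  simp only [Matrix.of_apply]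
  by_cases hσ : ∀ q : Fin i, (σ q : ℕ) ≤ q + 1
  · have h := IsHomogeneous.prod Finset.univ
      (fun q : Fin i => pairEsymm (X : Fin n → MvPolynomial (Fin n) ℤ) I (q + 1 - σ q))
      (fun q => q + 1 - σ q) fun q _ => isHomogeneous_pairEsymm I _
    have hdeg : ∑ q : Fin i, ((q : ℕ) + 1 - σ q) = i := by
      have h1 : ∑ q : Fin i, ((q : ℕ) + 1 - σ q) + ∑ q : Fin i, (σ q : ℕ)
          = ∑ q : Fin i, ((q : ℕ) + 1) := by
        rw [← Finset.sum_add_distrib]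
        exact Finset.sum_congr rfl fun q _ => Nat.sub_add_cancel (hσ q)
      rw [Equiv.sum_comp σ (fun q : Fin i => (q : ℕ)), Finset.sum_add_distrib] at h1
      simp at h1
      omega
    rw [hdeg] at h
    simpa only [hσ, if_true] using h
  · push Not at hσ
    obtain ⟨q, hq⟩ := hσ
    rw [Finset.prod_eq_zero (Finset.mem_univ q) (if_neg (by omega))]
    exact isHomogeneous_zero _ _ _

/-- The ring endomorphism of the polynomial ring substituting `X i` for `X j`. -/
noncomputable def identify (i j : Fin n) : MvPolynomial (Fin n) ℤ →+* MvPolynomial (Fin n) ℤ :=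
  (rename (Function.update id j i)).toRingHom

theorem identify_X (i j a : Fin n) : identify i j (X a) = X (if a = j then i else a) := by
  simp [identify, Function.update_apply]

theorem X_sub_X_dvd_sub_identify (i j : Fin n) (f : MvPolynomial (Fin n) ℤ) :
    X j - X i ∣ f - identify i j f := by
  induction f using MvPolynomial.induction_on with
  | C a => simp [identify]
  | add p q hp hq =>
    rw [map_add, add_sub_add_comm]
    exact dvd_add hp hq
  | mul_X p a hp =>
    have h : (X j - X i : MvPolynomial (Fin n) ℤ) ∣ X a - identify i j (X a) := by
      rw [identify_X]
      split_ifs with ha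
      · rw [ha]
      · simp
    rw [map_mul]
    exact dvd_mul_sub_mul hp h

theorem X_sub_X_dvd_iff {i j : Fin n} {f : MvPolynomial (Fin n) ℤ} :
    X j - X i ∣ f ↔ identify i j f = 0 := by
  refine ⟨?_, fun h => ?_⟩
  · rintro ⟨g, rfl⟩
    rw [map_mul, map_sub, identify_X, identify_X]
    simp
  · simpa [h] using X_sub_X_dvd_sub_identify i j f

theorem prime_X_sub_X {i j : Fin n} (hij : i ≠ j) :
    Prime (X j - X i : MvPolynomial (Fin n) ℤ) := by
  refine ⟨sub_ne_zero.2 fun h => hij (X_injective h).symm, fun h => ?_, fun a b h => ?_⟩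
  · exact one_ne_zero ((map_one _).symm.trans (X_sub_X_dvd_iff.1 (isUnit_iff_dvd_one.1 h)))
  · rw [X_sub_X_dvd_iff, map_mul, mul_eq_zero] at h
    simpa only [X_sub_X_dvd_iff] using h

/-- A product of pairwise non-associated linear forms `X j - X i` divides a polynomial as soon
as each factor does. -/
theorem prod_X_sub_X_dvd {s : Finset (Fin n × Fin n)} (hs : ∀ p ∈ s, p.1 ≠ p.2)
    (hs' : ∀ p ∈ s, p.swap ∉ s) {f : MvPolynomial (Fin n) ℤ}
    (hf : ∀ p ∈ s, X p.2 - X p.1 ∣ f) : ∏ p ∈ s, (X p.2 - X p.1) ∣ f := by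
  refine Finset.prod_dvd_of_isRelPrime (fun p hp q hq hpq => ?_) hf
  refine (prime_X_sub_X (hs p hp)).irreducible.isRelPrime_iff_not_dvd.2 fun h => ?_
  rw [X_sub_X_dvd_iff, map_sub, identify_X, identify_X, sub_eq_zero] at h
  have h := X_injective h
  have h1 := hs p hp
  have h2 := hs q hq
  have h3 := hs' p hp
  obtain ⟨a, b⟩ := p
  obtain ⟨c, d⟩ := q
  simp only [Prod.swap_prod_mk, ne_eq, Prod.mk.injEq] at *
  by_cases hd : d = b <;> by_cases hc : c = b <;> grind

/-- The Vandermonde determinant in the variables. -/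
noncomputable def vdm (n : ℕ) : MvPolynomial (Fin n) ℤ :=
  (Matrix.vandermonde X).det

theorem vdm_ne_zero : vdm n ≠ 0 :=
  Matrix.det_vandermonde_ne_zero_iff.2 X_injective

theorem map_vdm (f : MvPolynomial (Fin n) ℤ →+* R) :
    f (vdm n) = (Matrix.vandermonde (f ∘ X)).det := by
  rw [vdm, RingHom.map_det]
  congr 1
  ext p q
  simp [Matrix.vandermonde_apply]

theorem X_sub_X_dvd_vdm {i j : Fin n} (hij : i ≠ j) : X j - X i ∣ vdm n := by
  rw [X_sub_X_dvd_iff, map_vdm, Matrix.det_vandermonde_eq_zero_iff]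
  exact ⟨i, j, by simp [identify_X], hij⟩

theorem rename_swap_vdm {i j : Fin n} (hij : i ≠ j) :
    rename (Equiv.swap i j) (vdm n) = -vdm n := by
  have h := map_vdm (rename (R := ℤ) (Equiv.swap i j)).toRingHom
  refine h.trans ?_
  have h' := Matrix.det_permute (Equiv.swap i j)
    (Matrix.vandermonde (X : Fin n → MvPolynomial (Fin n) ℤ))
  rw [Equiv.Perm.sign_swap hij] at h'
  simp only [Units.val_neg, Units.val_one, Int.cast_neg, Int.cast_one, neg_mul, one_mul] at h'
  rw [vdm, ← h']
  congr 1
  ext p q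
  simp [Matrix.vandermonde_apply]

/-- A polynomial that changes sign under every transposition of the variables is divisible by
the Vandermonde determinant. -/
theorem vdm_dvd_of_alternating {f : MvPolynomial (Fin n) ℤ}
    (hf : ∀ i j : Fin n, i ≠ j → rename (Equiv.swap i j) f = -f) : vdm n ∣ f := by
  rw [vdm, Matrix.det_vandermonde, Finset.prod_sigma']
  have key (i j : Fin n) (hij : i ≠ j) : X j - X i ∣ f := by
    rw [X_sub_X_dvd_iff]
    have h : identify i j (rename (Equiv.swap i j) f) = identify i j f := by
      simp only [identify, AlgHom.toRingHom_eq_coe, RingHom.coe_coe, rename_rename]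
      congr 2
      ext a
      simp only [Function.comp_apply, Function.update_apply, Equiv.swap_apply_def]
      grind
    rw [hf i j hij, map_neg] at h
    exact self_eq_neg.1 h.symm
  have h := prod_X_sub_X_dvd (s := Finset.univ.filter fun p : Fin n × Fin n => p.1 < p.2)
    (f := f) (by simp +contextual [ne_of_lt]) (by simp +contextual [le_of_lt])
    fun p hp => key _ _ (Finset.mem_filter.1 hp).2.ne
  convert h using 1
  refine Finset.prod_bij' (fun p _ => (p.1, p.2)) (fun p _ => ⟨p.1, p.2⟩) ?_ ?_ ?_ ?_ ?_ <;> simp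

/-- The product of the differences `x j - x i` with `i ∈ I`, `j ∉ I`, over a commutative
ring. -/
def crossProd (x : Fin n → R) (I : Finset (Fin n)) : R :=
  ∏ i ∈ I, ∏ j ∈ Iᶜ, (x j - x i)

theorem map_crossProd (f : R →+* S) (x : Fin n → R) (I : Finset (Fin n)) :
    f (crossProd x I) = crossProd (f ∘ x) I := by
  simp [crossProd]

theorem map_compl_equiv (e : Equiv.Perm (Fin n)) (I : Finset (Fin n)) :
    Iᶜ.map e.toEmbedding = (I.map e.toEmbedding)ᶜ := by
  ext a
  simp [Finset.mem_map_equiv]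

theorem crossProd_comp_equiv (x : Fin n → R) (e : Equiv.Perm (Fin n)) (I : Finset (Fin n)) :
    crossProd (x ∘ e) I = crossProd x (I.map e.toEmbedding) := by
  simp [crossProd, ← map_compl_equiv]

theorem crossProd_dvd_vdm (I : Finset (Fin n)) :
    crossProd (X : Fin n → MvPolynomial (Fin n) ℤ) I ∣ vdm n := by
  rw [crossProd, ← Finset.prod_product']
  refine prod_X_sub_X_dvd (s := I ×ˢ Iᶜ) ?_ ?_ ?_
  · rintro ⟨a, b⟩ h (rfl : a = b)
    simp at h
  · rintro ⟨a, b⟩ h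
    simp at h ⊢
    tauto
  · rintro ⟨a, b⟩ h
    refine X_sub_X_dvd_vdm ?_
    rintro (rfl : a = b)
    simp at h

theorem crossProd_ne_zero [IsDomain R] {x : Fin n → R} (hx : Function.Injective x)
    (I : Finset (Fin n)) : crossProd x I ≠ 0 := by
  refine Finset.prod_ne_zero_iff.2 fun i hi => Finset.prod_ne_zero_iff.2 fun j hj => ?_
  refine sub_ne_zero.2 fun h => ?_
  rw [hx h] at hj
  exact Finset.mem_compl.1 hj hi

theorem isHomogeneous_crossProd (I : Finset (Fin n)) :
    (crossProd (X : Fin n → MvPolynomial (Fin n) ℤ) I).IsHomogeneous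
      (I.card * (n - I.card)) := by
  have h := IsHomogeneous.prod I
    (fun i => ∏ j ∈ Iᶜ, (X j - X i : MvPolynomial (Fin n) ℤ)) (fun _ => ∑ j ∈ Iᶜ, 1)
    fun i _ => IsHomogeneous.prod _ _ _ fun j _ => (isHomogeneous_X ℤ j).sub (isHomogeneous_X ℤ i)
  simpa [Finset.card_compl, crossProd] using h

/-- Localization-type sum: for symmetric data of total degree at most `r * (n - r)`, the sum of
`F I / crossProd x I` over the `r`-element subsets is an integer independent of `x`. -/
theorem exists_int_sum_div_crossProd (r : ℕ)
    (F : Finset (Fin n) → MvPolynomial (Fin n) ℤ)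
    (hF : ∀ (e : Equiv.Perm (Fin n)) (I), rename e (F I) = F (I.map e.toEmbedding))
    (hdeg : ∀ I, (F I).totalDegree ≤ r * (n - r)) :
    ∃ c : ℤ, ∀ x : Fin n → ℚ, Function.Injective x →
      ∑ I ∈ (Finset.univ : Finset (Fin n)).powersetCard r,
        aeval x (F I) / crossProd x I = c := by
  choose Q hQ using crossProd_dvd_vdm (n := n)
  have hT (I : Finset (Fin n)) := crossProd_ne_zero (X_injective (R := ℤ)) I
  have hQ0 (I : Finset (Fin n)) : Q I ≠ 0 := by
    intro h
    apply vdm_ne_zero (n := n)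
    rw [hQ I, h, mul_zero]
  have hswap (i j : Fin n) (hij : i ≠ j) (I : Finset (Fin n)) :
      rename (Equiv.swap i j) (Q I) = -Q (I.map (Equiv.swap i j).toEmbedding) := by
    have h := rename_swap_vdm hij
    conv_lhs at h => rw [hQ I, map_mul]
    have h' : rename (Equiv.swap i j) (crossProd (X : Fin n → MvPolynomial (Fin n) ℤ) I)
        = crossProd X (I.map (Equiv.swap i j).toEmbedding) := by
      rw [← crossProd_comp_equiv]
      refine (map_crossProd (rename (R := ℤ) (Equiv.swap i j)).toRingHom X I).trans ?_
      congr 1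
      ext1 a
      simp
    rw [h', hQ (I.map (Equiv.swap i j).toEmbedding), ← mul_neg] at h
    exact mul_left_cancel₀ (hT _) h
  set N := ∑ I ∈ (Finset.univ : Finset (Fin n)).powersetCard r, F I * Q I with hN
  obtain ⟨c, hc⟩ : vdm n ∣ N := by
    refine vdm_dvd_of_alternating fun i j hij => ?_
    rw [hN, map_sum, ← Finset.sum_neg_distrib]
    refine Finset.sum_equiv (Equiv.finsetCongr (Equiv.swap i j)) (by simp) fun I _ => ?_
    rw [map_mul, hF, hswap i j hij, mul_neg]
    rfl
  have hc0 : c.totalDegree = 0 := by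
    by_cases h : c = 0
    · simp [h]
    have h1 : N.totalDegree ≤ (vdm n).totalDegree := by
      refine totalDegree_finsetSum_le fun I hI => (totalDegree_mul _ _).trans ?_
      rw [hQ I, totalDegree_mul_of_isDomain (hT I) (hQ0 I),
        (isHomogeneous_crossProd I).totalDegree (hT I), (Finset.mem_powersetCard.1 hI).2]
      exact Nat.add_le_add_right (hdeg I) _
    rw [hc, totalDegree_mul_of_isDomain vdm_ne_zero h] at h1
    omega
  rw [totalDegree_eq_zero_iff_eq_C] at hc0
  refine ⟨coeff 0 c, fun x hx => ?_⟩
  have hV : aeval x (vdm n) ≠ 0 := by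
    have h := map_vdm (aeval (R := ℤ) x).toRingHom
    have h' : ((aeval (R := ℤ) x).toRingHom ∘ X : Fin n → ℚ) = x := by
      ext a
      simp
    rw [h'] at h
    exact fun h0 => Matrix.det_vandermonde_ne_zero_iff.2 hx (h.symm.trans h0)
  have hTx (I : Finset (Fin n)) : aeval x (crossProd (X : Fin n → MvPolynomial (Fin n) ℤ) I)
      = crossProd x I := by
    refine (map_crossProd (aeval (R := ℤ) x).toRingHom X I).trans ?_
    congr 1
    ext a
    simp
  have hev := congrArg (aeval x) hc
  rw [hc0, map_mul, aeval_C, hN, map_sum] at hev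
  rw [← mul_right_inj' hV, Finset.mul_sum]
  refine Eq.trans (Finset.sum_congr rfl fun I _ => ?_) hev
  rw [hQ I, map_mul, map_mul, hTx]
  field_simp [crossProd_ne_zero hx I]

theorem rename_pairDet_X (e : Equiv.Perm (Fin n)) (I : Finset (Fin n)) (i : ℕ) :
    rename e (pairDet (X : Fin n → MvPolynomial (Fin n) ℤ) I i)
      = pairDet X (I.map e.toEmbedding) i := by
  rw [← pairDet_comp_equiv]
  refine (map_pairDet (rename (R := ℤ) e).toRingHom X I i).trans ?_
  congr 1
  ext1 a
  simp

theorem aeval_pairDet_X (lam : Fin n → ℚ) (I : Finset (Fin n)) (i : ℕ) :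
    aeval lam (pairDet (X : Fin n → MvPolynomial (Fin n) ℤ) I i) = detA lam I i := by
  rw [detA_eq_pairDet]
  refine (map_pairDet (aeval (R := ℤ) lam).toRingHom X I i).trans ?_
  congr 1
  ext a
  simp

theorem choose_two_add_succ (r s : ℕ) :
    (r + s + 1).choose 2 = (r + 1).choose 2 + (s + 1).choose 2 + r * s := by
  have h (a : ℕ) : (a + 1).choose 2 * 2 = (a + 1) * a := by
    rw [Nat.choose_two_right, Nat.add_sub_cancel]
    exact Nat.div_mul_cancel (by simpa [mul_comm] using (Nat.even_mul_succ_self a).two_dvd)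
  linarith [h (r + s), h r, h s]

end BottResidue

/-- There is an integer `δ` such that for every tuple `λ` with pairwise distinct
coordinates, `(-1)^l ∑_I A_{k,Iᶜ}(λ) A_{l,I}(λ) / T_I(λ) = δ`, the sum running over
all `r`-element subsets `I` of `{1, …, n}`. -/
theorem bott_residue_sum_integer (n r m : ℕ) (hn : 0 < n) (hr : 0 < r) (hm : 0 < m)
    (hrn : r ≤ n) (h1 : (n - r + 1).choose 2 ≤ m)
    (h2 : (r + 1).choose 2 ≤ (n + 1).choose 2 - m)
    (k l : ℕ) (hk : k = m - (n - r + 1).choose 2)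
    (hl : l = (n + 1).choose 2 - m - (r + 1).choose 2) :
    ∃ δ : ℤ, ∀ lam : Fin n → ℚ, Function.Injective lam →
      (-1 : ℚ) ^ l * ∑ I ∈ (Finset.univ : Finset (Fin n)).powersetCard r,
          detA lam Iᶜ k * detA lam I l / prodT lam I = (δ : ℚ) := by
  have hdeg : k + l = r * (n - r) := by
    have hpos : 0 < (r + 1).choose 2 := Nat.choose_pos (by omega)
    have h := BottResidue.choose_two_add_succ r (n - r)
    rw [Nat.add_sub_cancel' hrn] at h
    omega
  obtain ⟨c, hc⟩ := BottResidue.exists_int_sum_div_crossProd (n := n) r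
    (fun I => BottResidue.pairDet MvPolynomial.X Iᶜ k * BottResidue.pairDet MvPolynomial.X I l)
    (fun e I => by
      rw [map_mul, BottResidue.rename_pairDet_X, BottResidue.rename_pairDet_X,
        BottResidue.map_compl_equiv])
    (fun I => hdeg ▸ ((BottResidue.isHomogeneous_pairDet Iᶜ k).mul
      (BottResidue.isHomogeneous_pairDet I l)).totalDegree_le)
  refine ⟨(-1) ^ l * c, fun lam hlam => ?_⟩
  push_cast
  rw [← hc lam hlam]
  simp only [map_mul, BottResidue.aeval_pairDet_X]
  rfl
end

section
/- Let $n, r, m$ be positive integers with $r \le n$, $\binom{n-r+1}{2} \le m$ and $\binom{r+1}{2} \le \binom{n+1}{2} - m$, and set $k = m - \binom{n-r+1}{2}$ and $l = \binom{n+1}{2} - m - \binom{r+1}{2}$. Regard the expression $\sum_{I} A_{k,I^c} \cdot A_{l,I} \cdot \prod_{J \ne I} T_J$, where $I$ and $J$ range over $r$-element subsets of $\{1,\dots,n\}$, as a polynomial in $\mathbb{Q}[\lambda_1,\dots,\lambda_n]$ (this is the numerator of the Bott residue sum $\sum_I A_{k,I^c} A_{l,I}/T_I$ after clearing denominators). Then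 this polynomial is divisible by $\prod_{J} T_J$ in $\mathbb{Q}[\lambda_1,\dots,\lambda_n]$, and the quotient is a constant polynomial. -/
open Finset MvPolynomial

/-- `c_{i,I}`: the `i`-th elementary symmetric polynomial in the linear forms
`λ i + λ j` for `i ≤ j`, `i, j ∈ I`, as an element of `ℚ[λ₁, …, λₙ]`. -/
noncomputable def esymCP {n : ℕ} (I : Finset (Fin n)) (i : ℕ) : MvPolynomial (Fin n) ℚ :=
  (I.sym2.val.map (Sym2.lift
    ⟨fun a b => MvPolynomial.X a + MvPolynomial.X b, fun a b => by ring⟩)).esymm i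

/-- `A_{i,I}`: the determinant of the `i × i` matrix whose `(p,q)` entry is
`c_{q-p+1,I}` when `q - p + 1 ≥ 0` (with `c_{0,I} = 1`) and `0` when `q - p + 1 < 0`.
For `i = 0` this is the empty determinant, which equals `1`. -/
noncomputable def detAP {n : ℕ} (I : Finset (Fin n)) (i : ℕ) : MvPolynomial (Fin n) ℚ :=
  Matrix.det (fun p q : Fin i =>
    if (p : ℕ) ≤ (q : ℕ) + 1 then esymCP I ((q : ℕ) + 1 - (p : ℕ)) else 0)

/-- `T_I = ∏_{i ∈ I} ∏_{j ∉ I} (λ j - λ i)` in `ℚ[λ₁, …, λₙ]`. -/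
noncomputable def prodTP {n : ℕ} (I : Finset (Fin n)) : MvPolynomial (Fin n) ℚ :=
  ∏ i ∈ I, ∏ j ∈ Iᶜ, (MvPolynomial.X j - MvPolynomial.X i)

section

variable {n : ℕ}

/-- A polynomial is congruent modulo `X a - X b` to the result of substituting `X b` for `X a`. -/
lemma X_sub_X_dvd_sub_aeval_update {σ R : Type*} [DecidableEq σ] [CommRing R] (a b : σ)
    (f : MvPolynomial σ R) :
    (X a - X b : MvPolynomial σ R) ∣
      f - aeval (Function.update X a (X b : MvPolynomial σ R)) f := by
  induction f using MvPolynomial.induction_on with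
  | C r => simp
  | add p q hp hq =>
    rw [map_add, add_sub_add_comm]
    exact dvd_add hp hq
  | mul_X p i hp =>
    have hX : (X a - X b : MvPolynomial σ R) ∣ X i - Function.update X a (X b) i := by
      by_cases h : i = a
      · subst h; simp
      · simp [Function.update_of_ne h]
    rw [map_mul, aeval_X]
    convert dvd_add (hp.mul_right (X i))
      (hX.mul_left (aeval (Function.update X a (X b)) p)) using 1
    ring

lemma X_sub_X_dvd_iff {σ R : Type*} [DecidableEq σ] [CommRing R] {a b : σ}
    {f : MvPolynomial σ R} :
    (X a - X b : MvPolynomial σ R) ∣ f ↔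
      aeval (Function.update X a (X b : MvPolynomial σ R)) f = 0 := by
  constructor
  · rintro ⟨g, rfl⟩
    by_cases h : b = a
    · subst h; simp
    · simp [Function.update_of_ne h]
  · intro h
    simpa only [h, sub_zero] using X_sub_X_dvd_sub_aeval_update a b f

lemma prime_X_sub_X {σ R : Type*} [DecidableEq σ] [CommRing R] [IsDomain R] {a b : σ}
    (h : a ≠ b) : Prime (X a - X b : MvPolynomial σ R) := by
  refine ⟨sub_ne_zero.2 fun e => h (X_injective e), fun hu => ?_, fun f g hfg => ?_⟩
  · have := X_sub_X_dvd_iff.1 (hu.dvd (a := (1 : MvPolynomial σ R)))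
    simp at this
  · rw [X_sub_X_dvd_iff, map_mul, mul_eq_zero] at hfg
    simpa only [X_sub_X_dvd_iff] using hfg

lemma isRelPrime_X_sub_X {σ R : Type*} [DecidableEq σ] [CommRing R] [IsDomain R] {a b c d : σ}
    (hab : a ≠ b) (hcd : c ≠ d) (h₁ : (a, b) ≠ (c, d)) (h₂ : (a, b) ≠ (d, c)) :
    IsRelPrime (X a - X b : MvPolynomial σ R) (X c - X d) := by
  rw [(prime_X_sub_X hab).irreducible.isRelPrime_iff_not_dvd, X_sub_X_dvd_iff, map_sub, aeval_X,
    aeval_X, sub_eq_zero]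
  have hX := X_injective (σ := σ) (R := R)
  simp only [ne_eq, Prod.mk.injEq] at h₁ h₂
  simp only [Function.update_apply]
  split_ifs with hc hd hd
  · exact absurd (hc.trans hd.symm) hcd
  · exact fun e => h₁ ⟨hc.symm, hX e⟩
  · exact fun e => h₂ ⟨hd.symm, (hX e).symm⟩
  · exact fun e => hcd (hX e)

lemma X_sub_X_dvd_of_rename_swap {σ R : Type*} [DecidableEq σ] [CommRing R] [IsDomain R]
    [CharZero R] {a b : σ} {f : MvPolynomial σ R} (hf : rename (Equiv.swap a b) f = -f) :
    (X a - X b : MvPolynomial σ R) ∣ f := by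
  rw [X_sub_X_dvd_iff]
  have h := congrArg (aeval (Function.update X a (X b : MvPolynomial σ R))) hf
  have hcomp : Function.update X a (X b : MvPolynomial σ R) ∘ Equiv.swap a b =
      Function.update X a (X b) := by
    funext i
    rw [Function.comp_apply]
    rcases eq_or_ne i a with rfl | ha
    · simp [Function.update_apply]
    rcases eq_or_ne i b with rfl | hb
    · simp [Function.update_apply]
    · rw [Equiv.swap_apply_of_ne_of_ne ha hb]
  rw [aeval_rename, hcomp, map_neg] at h
  exact self_eq_neg.1 h

lemma prod_X_sub_X_dvd {σ R : Type*} [DecidableEq σ] [CommRing R] [IsDomain R]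
    [UniqueFactorizationMonoid R] [CharZero R] {s : Finset (σ × σ)} (hs : ∀ p ∈ s, p.swap ∉ s) {f : MvPolynomial σ R}
    (hf : ∀ a b, a ≠ b → rename (Equiv.swap a b) f = -f) :
    ∏ p ∈ s, (X p.2 - X p.1 : MvPolynomial σ R) ∣ f := by
  have hne : ∀ p ∈ s, p.2 ≠ p.1 := by
    rintro ⟨a, b⟩ hp h
    obtain rfl : b = a := h
    exact hs _ hp hp
  refine Finset.prod_dvd_of_isRelPrime (fun p hp q hq hpq => ?_)
    fun p hp => X_sub_X_dvd_of_rename_swap (hf _ _ (hne p hp))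
  refine isRelPrime_X_sub_X (hne p hp) (hne q hq) (fun e => hpq ?_) fun e => hs p hp ?_
  · simp only [Prod.mk.injEq] at e
    exact Prod.ext e.2 e.1
  · have : p.swap = q := by
      simp only [Prod.mk.injEq] at e
      exact Prod.ext e.1 e.2
    exact this ▸ hq

/-- The Vandermonde determinant in the variables. -/
noncomputable def vandermondeDet (n : ℕ) : MvPolynomial (Fin n) ℚ :=
  (Matrix.vandermonde (X : Fin n → MvPolynomial (Fin n) ℚ)).det

lemma vandermondeDet_ne_zero : vandermondeDet n ≠ 0 :=
  Matrix.det_vandermonde_ne_zero_iff.2 X_injective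

lemma rename_swap_vandermondeDet {a b : Fin n} (h : a ≠ b) :
    rename (Equiv.swap a b) (vandermondeDet n) = -vandermondeDet n := by
  have hM : (rename (Equiv.swap a b)).mapMatrix
      (Matrix.vandermonde (X : Fin n → MvPolynomial (Fin n) ℚ)) =
      (Matrix.vandermonde X).submatrix (Equiv.swap a b) id := by
    ext1 i j
    simp [Matrix.vandermonde_apply]
  rw [vandermondeDet, AlgHom.map_det, hM, Matrix.det_permute, Equiv.Perm.sign_swap h]
  simp

lemma vandermondeDet_dvd {f : MvPolynomial (Fin n) ℚ}
    (hf : ∀ a b, a ≠ b → rename (Equiv.swap a b) f = -f) : vandermondeDet n ∣ f := by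
  have : vandermondeDet n = ∏ p ∈ (univ : Finset (Fin n × Fin n)).filter (fun p => p.1 < p.2),
      (X p.2 - X p.1) := by
    rw [vandermondeDet, Matrix.det_vandermonde, Finset.prod_filter, Fintype.prod_prod_type]
    refine Finset.prod_congr rfl fun i _ => ?_
    rw [← Finset.prod_filter]
    refine Finset.prod_congr ?_ fun _ _ => rfl
    ext j
    simp
  rw [this]
  refine prod_X_sub_X_dvd (fun p hp => ?_) hf
  simp only [mem_filter, mem_univ, true_and] at hp
  simpa using hp.le

lemma prodTP_dvd_vandermondeDet (I : Finset (Fin n)) : prodTP I ∣ vandermondeDet n := by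
  rw [prodTP, ← Finset.prod_product']
  refine prod_X_sub_X_dvd (s := I ×ˢ Iᶜ) (fun p hp => ?_)
    fun a b h => rename_swap_vandermondeDet h
  simp only [mem_product, mem_compl] at hp
  simp [hp.2]

lemma prodTP_ne_zero (I : Finset (Fin n)) : prodTP I ≠ 0 :=
  ne_zero_of_dvd_ne_zero vandermondeDet_ne_zero (prodTP_dvd_vandermondeDet I)

lemma rename_prodTP (e : Equiv.Perm (Fin n)) (I : Finset (Fin n)) :
    rename e (prodTP I) = prodTP (I.map e.toEmbedding) := by
  have hc : (I.map e.toEmbedding)ᶜ = Iᶜ.map e.toEmbedding := by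
    ext j; simp
  simp [prodTP, hc, Finset.prod_map]

lemma rename_esymCP (e : Equiv.Perm (Fin n)) (I : Finset (Fin n)) (i : ℕ) :
    rename e (esymCP I i) = esymCP (I.map e.toEmbedding) i := by
  rw [esymCP, esymCP, Finset.sym2_map, Finset.map_val, Multiset.map_map]
  simp only [Multiset.esymm, map_multiset_sum, Multiset.powersetCard_map, Multiset.map_map]
  congr 1
  refine Multiset.map_congr rfl fun s _ => ?_
  simp only [Function.comp_apply, map_multiset_prod, Multiset.map_map]
  congr 1
  refine Multiset.map_congr rfl fun z _ => ?_
  induction z using Sym2.ind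
  simp

lemma detAP_eq_det_of (I : Finset (Fin n)) (i : ℕ) :
    detAP I i = (Matrix.of fun p q : Fin i =>
      if (p : ℕ) ≤ (q : ℕ) + 1 then esymCP I ((q : ℕ) + 1 - (p : ℕ)) else 0).det :=
  rfl

lemma rename_detAP (e : Equiv.Perm (Fin n)) (I : Finset (Fin n)) (i : ℕ) :
    rename e (detAP I i) = detAP (I.map e.toEmbedding) i := by
  rw [detAP_eq_det_of, detAP_eq_det_of, AlgHom.map_det]
  congr 1
  ext1 p q
  simp only [AlgHom.mapMatrix_apply, Matrix.map_apply, Matrix.of_apply, apply_ite (rename e), rename_esymCP,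
    map_zero]

lemma isHomogeneous_esymCP (I : Finset (Fin n)) (i : ℕ) : (esymCP I i).IsHomogeneous i := by
  rw [esymCP, Multiset.esymm, Multiset.powersetCard_map, Multiset.map_map]
  refine Multiset.sum_induction (fun p : MvPolynomial (Fin n) ℚ => p.IsHomogeneous i) _ (fun _ _ => IsHomogeneous.add)
    (isHomogeneous_zero _ _ _) fun p hp => ?_
  obtain ⟨s, hs, rfl⟩ := Multiset.mem_map.1 hp
  rw [← (Multiset.mem_powersetCard.1 hs).2, Function.comp_apply]
  clear hs hp
  induction s using Multiset.induction_on with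
  | empty => simpa using isHomogeneous_one _ _
  | cons z s ih =>
    rw [Multiset.map_cons, Multiset.prod_cons, Multiset.card_cons, add_comm]
    refine IsHomogeneous.mul ?_ ih
    induction z using Sym2.ind
    exact (isHomogeneous_X _ _).add (isHomogeneous_X _ _)

lemma isHomogeneous_detAP (I : Finset (Fin n)) (i : ℕ) : (detAP I i).IsHomogeneous i := by
  rw [detAP_eq_det_of, Matrix.det_apply]
  simp only [Matrix.of_apply]
  refine IsHomogeneous.sum _ _ _ fun e _ => ?_
  rw [Units.smul_def, zsmul_eq_mul]
  refine (mem_homogeneousSubmodule i _).1 ?_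
  rw [← zsmul_eq_mul]
  refine zsmul_mem ?_ _
  rw [mem_homogeneousSubmodule]
  by_cases h : ∀ p, (e p : ℕ) ≤ (p : ℕ) + 1
  · have hdeg : ∑ p : Fin i, ((p : ℕ) + 1 - (e p : ℕ)) = i := by
      have h₁ : ∑ p : Fin i, ((p : ℕ) + 1 - (e p : ℕ)) + ∑ p : Fin i, (e p : ℕ) =
          ∑ p : Fin i, ((p : ℕ) + 1) := by
        rw [← Finset.sum_add_distrib]
        exact Finset.sum_congr rfl fun p _ => Nat.sub_add_cancel (h p)
      rw [Equiv.sum_comp e (fun p : Fin i => (p : ℕ)), Finset.sum_add_distrib] at h₁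
      simp only [sum_const, card_univ, Fintype.card_fin, smul_eq_mul, mul_one] at h₁
      omega
    have := IsHomogeneous.prod univ (fun p : Fin i => esymCP I ((p : ℕ) + 1 - (e p : ℕ))) _
      fun p _ => isHomogeneous_esymCP I _
    rw [hdeg] at this
    simpa [h] using this
  · push Not at h
    obtain ⟨p, hp⟩ := h
    rw [Finset.prod_eq_zero (mem_univ p) (if_neg (not_le.2 hp))]
    exact isHomogeneous_zero _ _ _

lemma isHomogeneous_prodTP (I : Finset (Fin n)) : (prodTP I).IsHomogeneous (#I * #Iᶜ) := by
  have := IsHomogeneous.prod I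
    (fun i => ∏ j ∈ Iᶜ, (X j - X i : MvPolynomial (Fin n) ℚ)) (fun _ => #Iᶜ) fun i _ => by
      simpa using IsHomogeneous.prod Iᶜ (fun j => (X j - X i : MvPolynomial (Fin n) ℚ))
        (fun _ => 1) fun j _ => (isHomogeneous_X _ _).sub (isHomogeneous_X _ _)
  simpa [prodTP] using this

/-- Clearing denominators in a sum of rational functions `f I / T_I` that is permuted by the
symmetric group leaves a multiple of the common denominator. -/
lemma prod_prodTP_dvd_sum (r : ℕ) (f : Finset (Fin n) → MvPolynomial (Fin n) ℚ)
    (hf : ∀ (e : Equiv.Perm (Fin n)) I, rename e (f I) = f (I.map e.toEmbedding)) :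
    ∏ J ∈ (univ : Finset (Fin n)).powersetCard r, prodTP J ∣
      ∑ I ∈ (univ : Finset (Fin n)).powersetCard r,
        f I * ∏ J ∈ ((univ : Finset (Fin n)).powersetCard r).erase I, prodTP J := by
  choose U hU using prodTP_dvd_vandermondeDet (n := n)
  have hswap : ∀ a b, a ≠ b → ∀ I,
      rename (Equiv.swap a b) (U I) = -U (I.map (Equiv.swap a b).toEmbedding) := by
    intro a b h I
    refine mul_left_cancel₀ (prodTP_ne_zero (I.map (Equiv.swap a b).toEmbedding)) ?_
    rw [← rename_prodTP, ← map_mul, ← hU, rename_swap_vandermondeDet h, rename_prodTP, mul_neg,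
      ← hU]
  obtain ⟨q, hq⟩ : vandermondeDet n ∣
      ∑ I ∈ (univ : Finset (Fin n)).powersetCard r, f I * U I := by
    refine vandermondeDet_dvd fun a b h => ?_
    rw [map_sum, ← Finset.sum_neg_distrib]
    refine Finset.sum_bij' (fun I _ => I.map (Equiv.swap a b).toEmbedding)
      (fun I _ => I.map (Equiv.swap a b).toEmbedding) ?_ ?_ ?_ ?_ ?_
    · intro I hI; simpa using hI
    · intro I hI; simpa using hI
    · intro I _; ext; simp
    · intro I _; ext; simp
    · intro I _
      rw [map_mul, hf, hswap a b h, mul_neg]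
  refine ⟨q, mul_left_cancel₀ vandermondeDet_ne_zero ?_⟩
  rw [mul_left_comm, ← hq, Finset.mul_sum, Finset.mul_sum]
  refine Finset.sum_congr rfl fun I hI => ?_
  rw [← Finset.mul_prod_erase _ _ hI, hU I]
  ring

lemma choose_two_add_succ (r s : ℕ) :
    (r + s + 1).choose 2 = (r + 1).choose 2 + (s + 1).choose 2 + r * s := by
  induction s with
  | zero => simp
  | succ s ih =>
    rw [← add_assoc, Nat.choose_succ_succ' (r + s + 1) 1, Nat.choose_succ_succ' (s + 1) 1, ih,
      Nat.choose_one_right, Nat.choose_one_right]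
    ring

end

/-- The numerator `∑_I A_{k,Iᶜ} · A_{l,I} · ∏_{J ≠ I} T_J` of the Bott residue sum,
after clearing denominators, is divisible by `∏_J T_J` in `ℚ[λ₁, …, λₙ]`
with constant quotient. -/
theorem bott_residue_numerator_const_multiple (n r m : ℕ) (hn : 0 < n) (hr : 0 < r)
    (hm : 0 < m) (hrn : r ≤ n) (h1 : (n - r + 1).choose 2 ≤ m)
    (h2 : (r + 1).choose 2 ≤ (n + 1).choose 2 - m)
    (k l : ℕ) (hk : k = m - (n - r + 1).choose 2)
    (hl : l = (n + 1).choose 2 - m - (r + 1).choose 2) :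
    ∃ c : ℚ,
      ∑ I ∈ (Finset.univ : Finset (Fin n)).powersetCard r,
          detAP Iᶜ k * detAP I l *
            ∏ J ∈ ((Finset.univ : Finset (Fin n)).powersetCard r).erase I, prodTP J =
        MvPolynomial.C c *
          ∏ J ∈ (Finset.univ : Finset (Fin n)).powersetCard r, prodTP J := by
  have hkl : k + l = r * (n - r) := by
    obtain ⟨s, rfl⟩ := Nat.exists_eq_add_of_le hrn
    have hpos : 0 < (r + 1).choose 2 := Nat.choose_pos (by omega)
    have := choose_two_add_succ r s
    rw [Nat.add_sub_cancel_left] at *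
    omega
  obtain ⟨q, hq⟩ := prod_prodTP_dvd_sum r (fun I : Finset (Fin n) => detAP Iᶜ k * detAP I l)
    fun e I => by
      have hc : (I.map e.toEmbedding)ᶜ = Iᶜ.map e.toEmbedding := by
        ext j; simp
      rw [map_mul, rename_detAP, rename_detAP, hc]
  set D := ∏ J ∈ (univ : Finset (Fin n)).powersetCard r, prodTP J with hD
  have hD₀ : D ≠ 0 := Finset.prod_ne_zero_iff.2 fun J _ => prodTP_ne_zero J
  have hDhom := IsHomogeneous.prod ((univ : Finset (Fin n)).powersetCard r) prodTP _
    fun J _ => isHomogeneous_prodTP J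
  rw [← hD] at hDhom
  have hdeg : (D * q).totalDegree ≤ D.totalDegree := by
    rw [← hq, hDhom.totalDegree hD₀]
    refine IsHomogeneous.totalDegree_le (IsHomogeneous.sum _ _ _ fun I hI => ?_)
    have hcard : #I * #Iᶜ = k + l := by
      rw [card_compl, (mem_powersetCard.1 hI).2, Fintype.card_fin, hkl]
    rw [← Finset.add_sum_erase _ _ hI, hcard]
    exact ((isHomogeneous_detAP _ _).mul (isHomogeneous_detAP _ _)).mul
      (IsHomogeneous.prod _ _ _ fun J _ => isHomogeneous_prodTP J)
  have hq₀ : q.totalDegree = 0 := by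
    rcases eq_or_ne q 0 with rfl | h
    · simp
    · rw [totalDegree_mul_of_isDomain hD₀ h] at hdeg
      omega
  refine ⟨q.coeff 0, ?_⟩
  rw [← totalDegree_eq_zero_iff_eq_C.1 hq₀, mul_comm]
  exact hq
end
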